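/- Let {X_n : n ∈ (ℤ₊)^d} be random variables and X a random variable such that for some constant M ≥ 0 and all x ≥ 0 and all n ∈ (ℤ₊)^d, (1/|n|) ∑_{k ⪯ n} P(|X_k| > x) ≤ M P(|X| > x), where |n| = n₁⋯n_d. If 1 < p < 2, 1 ≤ r ≤ p, and E[|X|^p (log⁺|X|)^{d-1}] < ∞, then ∑_{n ∈ (ℤ₊)^d} |n|^{(p-1)/r - 2} ∑_{k ⪯ n} E[|X_k|·1{|X_k| > |n|^{1/r}}] < ∞. -/

import Mathlib

open MeasureTheory ENNReal

/-- `pidx n = n₁ ⋯ n_d` for `n ∈ (ℤ₊)^d`. -/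
def pidx {d : ℕ} (n : Fin d → ℕ+) : ℕ := ∏ i, (n i : ℕ)

/-- The truncated first moment as an integral of tail probabilities. -/
theorem setLIntegral_abs_eq_lintegral_tail {Ω : Type*} [MeasurableSpace Ω] (P : Measure Ω)
    {Z : Ω → ℝ} (hZ : Measurable Z) (a : ℝ) :
    ∫⁻ ω in {ω | a < |Z ω|}, ENNReal.ofReal |Z ω| ∂P
      = ∫⁻ t in Set.Ioi (0 : ℝ), P {ω | max t a < |Z ω|} := by
  have hs : MeasurableSet {ω | a < |Z ω|} := measurableSet_lt measurable_const hZ.abs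
  have hf : Measurable (Set.indicator {ω | a < |Z ω|} fun ω => |Z ω|) := hZ.abs.indicator hs
  have h := lintegral_eq_lintegral_meas_lt P
    (Filter.Eventually.of_forall fun ω => Set.indicator_nonneg (fun ω _ => abs_nonneg (Z ω)) ω)
    hf.aemeasurable
  rw [← lintegral_indicator hs]
  convert h using 1
  · refine lintegral_congr fun ω => ?_
    by_cases hω : a < |Z ω| <;> simp [Set.indicator, hω]
  · refine setLIntegral_congr_fun measurableSet_Ioi fun t ht => ?_
    congr 1
    ext ω
    have ht' : 0 < t := ht
    by_cases hω : a < |Z ω| <;> simp [Set.indicator, hω, ht'.le]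

/-- Domination of tails passes to truncated first moments. -/
theorem sum_setLIntegral_abs_le_of_tail_le {Ω ι : Type*} [MeasurableSpace Ω] (P : Measure Ω)
    (s : Finset ι) {X : ι → Ω → ℝ} {Y : Ω → ℝ} (hX : ∀ k, Measurable (X k)) (hY : Measurable Y)
    {c : ℝ≥0∞} (hc : ∀ x : ℝ, 0 ≤ x →
      ∑ k ∈ s, P {ω | x < |X k ω|} ≤ c * P {ω | x < |Y ω|})
    {a : ℝ} (ha : 0 ≤ a) :
    ∑ k ∈ s, ∫⁻ ω in {ω | a < |X k ω|}, ENNReal.ofReal |X k ω| ∂P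
      ≤ c * ∫⁻ ω in {ω | a < |Y ω|}, ENNReal.ofReal |Y ω| ∂P := by
  have hmeas : ∀ Z : Ω → ℝ, Measurable fun t : ℝ => P {ω | max t a < |Z ω|} := fun Z =>
    Antitone.measurable fun t u htu =>
      measure_mono fun ω hω => lt_of_le_of_lt (max_le_max_right a htu) hω
  simp_rw [fun k => setLIntegral_abs_eq_lintegral_tail P (hX k) a,
    setLIntegral_abs_eq_lintegral_tail P hY a]
  rw [← lintegral_finsetSum _ fun k _ => hmeas (X k), ← lintegral_const_mul _ (hmeas Y)]
  exact lintegral_mono fun t => hc _ (ha.trans (le_max_right t a))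

theorem sum_Icc_rpow_sub_one_le {β : ℝ} (hβ : 0 < β) (hβ1 : β ≤ 1) (N : ℕ) :
    ∑ k ∈ Finset.Icc 1 N, (k : ℝ) ^ (β - 1) ≤ β⁻¹ * (N : ℝ) ^ β := by
  induction N with
  | zero => simp [Real.zero_rpow hβ.ne']
  | succ N ih =>
    rw [Finset.sum_Icc_succ_top (by omega)]
    have hN : (0 : ℝ) < ((N + 1 : ℕ) : ℝ) := by positivity
    have hb := rpow_one_add_le_one_add_mul_self (s := -(((N + 1 : ℕ) : ℝ)⁻¹))
      (by rw [neg_le_neg_iff]; exact inv_le_one_of_one_le₀ (by simp)) hβ.le hβ1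
    have hNe : (1 + -(((N + 1 : ℕ) : ℝ)⁻¹)) * ((N + 1 : ℕ) : ℝ) = N := by
      rw [add_mul, neg_mul, inv_mul_cancel₀ hN.ne']; push_cast; ring
    have hnn : 0 ≤ 1 + -(((N + 1 : ℕ) : ℝ)⁻¹) := by
      have : (((N + 1 : ℕ) : ℝ)⁻¹) ≤ 1 := inv_le_one_of_one_le₀ (by simp)
      linarith
    have hstep : (N : ℝ) ^ β + β * ((N + 1 : ℕ) : ℝ) ^ (β - 1) ≤ ((N + 1 : ℕ) : ℝ) ^ β := by
      have h1 : (N : ℝ) ^ β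
          ≤ (1 + β * -(((N + 1 : ℕ) : ℝ)⁻¹)) * ((N + 1 : ℕ) : ℝ) ^ β := by
        rw [← hNe, Real.mul_rpow hnn hN.le]
        gcongr
      rw [Real.rpow_sub_one hN.ne', div_eq_mul_inv]
      linarith
    calc _ ≤ β⁻¹ * (N : ℝ) ^ β + ((N + 1 : ℕ) : ℝ) ^ (β - 1) := by gcongr
      _ = β⁻¹ * ((N : ℝ) ^ β + β * ((N + 1 : ℕ) : ℝ) ^ (β - 1)) := by field_simp
      _ ≤ _ := by gcongr

theorem tsum_pnat_ite_le_sum_Icc (f : ℕ → ℝ≥0∞) {T : ℝ} (hT : 0 ≤ T) :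
    ∑' k : ℕ+, (if ((k : ℕ) : ℝ) ≤ T then f k else 0) ≤ ∑ k ∈ Finset.Icc 1 ⌊T⌋₊, f k := by
  have hinj : Function.Injective fun k : ℕ+ => (k : ℕ) := PNat.coe_injective
  calc _ = ∑' k : ℕ+, (Finset.Icc 1 ⌊T⌋₊ : Set ℕ).indicator f k := by
        refine tsum_congr fun k => ?_
        simp [Set.indicator, Nat.le_floor_iff hT, Nat.one_le_iff_ne_zero]
    _ ≤ ∑' k : ℕ, (Finset.Icc 1 ⌊T⌋₊ : Set ℕ).indicator f k :=
        ENNReal.tsum_comp_le_tsum_of_injective hinj _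
    _ = _ := (sum_eq_tsum_indicator f _).symm

theorem pidx_cons {d : ℕ} (k : ℕ+) (m : Fin d → ℕ+) :
    pidx (Fin.cons k m : Fin (d + 1) → ℕ+) = k * pidx m := by
  simp [pidx, Fin.prod_univ_succ]

theorem one_le_pidx {d : ℕ} (n : Fin d → ℕ+) : 1 ≤ pidx n :=
  Finset.prod_pos fun i _ => (n i).pos

theorem tsum_fin_succ_pnat {d : ℕ} (f : (Fin (d + 1) → ℕ+) → ℝ≥0∞) :
    ∑' n, f n = ∑' k : ℕ+, ∑' m : Fin d → ℕ+, f (Fin.cons k m) := by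
  rw [← (Fin.consEquiv fun _ : Fin (d + 1) => ℕ+).tsum_eq, ENNReal.tsum_prod']
  rfl

/-- Weighted count of lattice points below the hyperbolic surface `n₁ ⋯ n_{d+1} ≤ T`. -/
theorem tsum_pidx_rpow_le {β : ℝ} (hβ : 0 < β) (hβ1 : β ≤ 1) (d : ℕ) {T : ℝ} (hT : 1 ≤ T) :
    ∑' n : Fin (d + 1) → ℕ+,
        (if (pidx n : ℝ) ≤ T then ENNReal.ofReal ((pidx n : ℝ) ^ (β - 1)) else 0)
      ≤ ENNReal.ofReal (β⁻¹ * T ^ β * (1 + Real.log T) ^ d) := by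
  have hT0 : 0 ≤ T := by linarith
  induction d generalizing T with
  | zero =>
    rw [tsum_fin_succ_pnat]
    simp_rw [tsum_fintype, Fintype.sum_unique, pidx_cons]
    simp only [pidx, Finset.univ_eq_empty, Finset.prod_empty, mul_one, pow_zero]
    refine (tsum_pnat_ite_le_sum_Icc (fun k => ENNReal.ofReal ((k : ℝ) ^ (β - 1))) hT0).trans ?_
    rw [← ENNReal.ofReal_sum_of_nonneg fun k _ => by positivity]
    refine ENNReal.ofReal_le_ofReal ((sum_Icc_rpow_sub_one_le hβ hβ1 _).trans ?_)
    gcongr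
    exact Nat.floor_le hT0
  | succ d ih =>
    have hL : 0 ≤ Real.log T := Real.log_nonneg hT
    rw [tsum_fin_succ_pnat]
    have hslice : ∀ k : ℕ+, ∑' m : Fin (d + 1) → ℕ+,
        (if (pidx (Fin.cons k m : Fin (d + 2) → ℕ+) : ℝ) ≤ T then
          ENNReal.ofReal ((pidx (Fin.cons k m : Fin (d + 2) → ℕ+) : ℝ) ^ (β - 1)) else 0)
        ≤ if ((k : ℕ) : ℝ) ≤ T then
          ENNReal.ofReal (β⁻¹ * T ^ β * (1 + Real.log T) ^ d * ((k : ℕ) : ℝ)⁻¹) else 0 := by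
      intro k
      have hk1 : (1 : ℝ) ≤ ((k : ℕ) : ℝ) := by exact_mod_cast k.pos
      have hk0 : (0 : ℝ) < ((k : ℕ) : ℝ) := by linarith
      simp only [pidx_cons, Nat.cast_mul]
      split_ifs with hk
      · have hTk : 1 ≤ T / ((k : ℕ) : ℝ) := (one_le_div hk0).2 hk
        calc _ = ∑' m : Fin (d + 1) → ℕ+, ENNReal.ofReal (((k : ℕ) : ℝ) ^ (β - 1)) *
              (if (pidx m : ℝ) ≤ T / ((k : ℕ) : ℝ) then
                ENNReal.ofReal ((pidx m : ℝ) ^ (β - 1)) else 0) := by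
              refine tsum_congr fun m => ?_
              simp only [le_div_iff₀' hk0]
              split_ifs
              · rw [Real.mul_rpow hk0.le (Nat.cast_nonneg _), ENNReal.ofReal_mul (by positivity)]
              · simp
          _ ≤ ENNReal.ofReal (((k : ℕ) : ℝ) ^ (β - 1)) * ENNReal.ofReal
              (β⁻¹ * (T / ((k : ℕ) : ℝ)) ^ β * (1 + Real.log (T / ((k : ℕ) : ℝ))) ^ d) := by
              rw [ENNReal.tsum_mul_left]
              gcongr
              exact ih hTk (by linarith)
          _ ≤ _ := by
              rw [← ENNReal.ofReal_mul (by positivity)]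
              refine ENNReal.ofReal_le_ofReal ?_
              have hlog : Real.log (T / ((k : ℕ) : ℝ)) ≤ Real.log T :=
                Real.log_le_log (by linarith) (div_le_self hT0 hk1)
              have hlog0 : 0 ≤ Real.log (T / ((k : ℕ) : ℝ)) := Real.log_nonneg hTk
              calc _ ≤ ((k : ℕ) : ℝ) ^ (β - 1) *
                    (β⁻¹ * (T / ((k : ℕ) : ℝ)) ^ β * (1 + Real.log T) ^ d) := by gcongr
                _ = _ := by
                  rw [Real.div_rpow hT0 hk0.le, Real.rpow_sub_one hk0.ne']
                  have := (Real.rpow_pos_of_pos hk0 β).ne'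
                  field_simp
      · refine (ENNReal.tsum_eq_zero.2 fun m => if_neg fun h => hk (le_trans ?_ h)).le
        exact le_mul_of_one_le_right hk0.le (by exact_mod_cast one_le_pidx m)
    refine (ENNReal.tsum_le_tsum hslice).trans ?_
    refine (tsum_pnat_ite_le_sum_Icc (fun k =>
      ENNReal.ofReal (β⁻¹ * T ^ β * (1 + Real.log T) ^ d * (k : ℝ)⁻¹)) hT0).trans ?_
    rw [← ENNReal.ofReal_sum_of_nonneg fun k _ => by positivity, ← Finset.mul_sum, pow_succ,
      ← mul_assoc]
    refine ENNReal.ofReal_le_ofReal ?_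
    gcongr
    have h := harmonic_floor_le_one_add_log T hT
    rw [harmonic_eq_sum_Icc] at h
    push_cast at h
    exact h

/-- The sum of `|n|^{(p-1)/r-1}` over the indices with `|n|^{1/r} < y`, times `y`, is at most a
multiple of `y^p (log⁺ y)^{d-1}`. -/
theorem tsum_pidx_truncated_le {p r : ℝ} (hp1 : 1 < p) (hp2 : p < 2) (hr1 : 1 ≤ r) (d : ℕ)
    {y : ℝ} (hy : 0 ≤ y) :
    ∑' n : Fin (d + 1) → ℕ+, (if (pidx n : ℝ) ^ (1 / r) < y then
        ENNReal.ofReal ((pidx n : ℝ) ^ ((p - 1) / r - 1)) * ENNReal.ofReal y else 0)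
      ≤ ENNReal.ofReal (((p - 1) / r)⁻¹ * (1 + r) ^ d) *
        ENNReal.ofReal (y ^ p * max 1 (Real.log y) ^ d) := by
  have hr0 : 0 < r := by linarith
  have hβ : 0 < (p - 1) / r := div_pos (by linarith) hr0
  have hβ1 : (p - 1) / r ≤ 1 := (div_le_one hr0).2 (by linarith)
  rcases lt_or_ge y 1 with hy1 | hy1
  · refine (ENNReal.tsum_eq_zero.2 fun n => if_neg fun h => ?_).le.trans zero_le
    have : (1 : ℝ) ≤ (pidx n : ℝ) ^ (1 / r) :=
      Real.one_le_rpow (by exact_mod_cast one_le_pidx n) (by positivity)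
    linarith
  · have hy0 : 0 < y := by linarith
    have hT : 1 ≤ y ^ r := Real.one_le_rpow hy1 hr0.le
    calc _ ≤ ∑' n : Fin (d + 1) → ℕ+, (if (pidx n : ℝ) ≤ y ^ r then
            ENNReal.ofReal ((pidx n : ℝ) ^ ((p - 1) / r - 1)) else 0) * ENNReal.ofReal y := by
          refine ENNReal.tsum_le_tsum fun n => ?_
          split_ifs with h1 h2
          · exact le_rfl
          · refine absurd ?_ h2
            have := Real.rpow_le_rpow (by positivity) h1.le hr0.le
            rwa [← Real.rpow_mul (Nat.cast_nonneg _), one_div_mul_cancel hr0.ne',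
              Real.rpow_one] at this
          · exact zero_le
          · exact zero_le
      _ ≤ ENNReal.ofReal (((p - 1) / r)⁻¹ * (y ^ r) ^ ((p - 1) / r) *
            (1 + Real.log (y ^ r)) ^ d) * ENNReal.ofReal y := by
          rw [ENNReal.tsum_mul_right]
          gcongr
          exact tsum_pidx_rpow_le hβ hβ1 d hT
      _ ≤ _ := by
          rw [← ENNReal.ofReal_mul' hy, ← ENNReal.ofReal_mul (by positivity)]
          refine ENNReal.ofReal_le_ofReal ?_
          have hyp : (y ^ r) ^ ((p - 1) / r) * y = y ^ p := by
            rw [← Real.rpow_mul hy, mul_div_cancel₀ _ hr0.ne', Real.rpow_sub_one hy0.ne',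
              div_mul_cancel₀ _ hy0.ne']
          have hlog : 1 + Real.log (y ^ r) ≤ (1 + r) * max 1 (Real.log y) := by
            rw [Real.log_rpow hy0, add_mul, one_mul]
            gcongr
            · exact le_max_left _ _
            · exact le_max_right _ _
          have hlog0 : 0 ≤ Real.log (y ^ r) := Real.log_nonneg hT
          calc _ = ((p - 1) / r)⁻¹ * y ^ p * (1 + Real.log (y ^ r)) ^ d := by
                rw [← hyp]; ring
            _ ≤ ((p - 1) / r)⁻¹ * y ^ p * ((1 + r) * max 1 (Real.log y)) ^ d := by gcongr
            _ = _ := by rw [mul_pow]; ring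

theorem stmt8 {Ω : Type*} [MeasurableSpace Ω] (P : Measure Ω) [IsProbabilityMeasure P]
    {d : ℕ} (hd : 1 ≤ d)
    (X : (Fin d → ℕ+) → Ω → ℝ) (Y : Ω → ℝ)
    (hX : ∀ k, Measurable (X k)) (hY : Measurable Y)
    (M : ℝ) (hM : 0 ≤ M)
    (hMD : ∀ x : ℝ, 0 ≤ x → ∀ n : Fin d → ℕ+,
      ∑ k ∈ Finset.Icc 1 n, P {ω : Ω | x < |X k ω|}
        ≤ (pidx n : ℝ≥0∞) * ENNReal.ofReal M * P {ω : Ω | x < |Y ω|})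
    (p r : ℝ) (hp1 : 1 < p) (hp2 : p < 2) (hr1 : 1 ≤ r) (hrp : r ≤ p)
    (hmom : ∫⁻ ω, ENNReal.ofReal (|Y ω| ^ p * (max 1 (Real.log |Y ω|)) ^ (d - 1)) ∂P < ∞) :
    ∑' n : Fin d → ℕ+,
      ENNReal.ofReal ((pidx n : ℝ) ^ ((p - 1) / r - 2)) *
        ∑ k ∈ Finset.Icc 1 n,
          ∫⁻ ω in {ω : Ω | (pidx n : ℝ) ^ (1 / r) < |X k ω|},
            ENNReal.ofReal |X k ω| ∂P < ∞ := by
  obtain ⟨d, rfl⟩ : ∃ e, d = e + 1 := ⟨d - 1, by omega⟩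
  rw [Nat.add_sub_cancel] at hmom
  have hset : ∀ n : Fin (d + 1) → ℕ+,
      MeasurableSet {ω : Ω | (pidx n : ℝ) ^ (1 / r) < |Y ω|} := fun n =>
    measurableSet_lt measurable_const hY.abs
  have hterm : ∀ n : Fin (d + 1) → ℕ+,
      ENNReal.ofReal ((pidx n : ℝ) ^ ((p - 1) / r - 2)) *
        ∑ k ∈ Finset.Icc 1 n, ∫⁻ ω in {ω : Ω | (pidx n : ℝ) ^ (1 / r) < |X k ω|},
          ENNReal.ofReal |X k ω| ∂P
      ≤ ENNReal.ofReal M * ∫⁻ ω, (if (pidx n : ℝ) ^ (1 / r) < |Y ω| then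
          ENNReal.ofReal ((pidx n : ℝ) ^ ((p - 1) / r - 1)) * ENNReal.ofReal |Y ω| else 0) ∂P := by
    intro n
    have hn : (0 : ℝ) < pidx n := by exact_mod_cast one_le_pidx n
    have hexp : ENNReal.ofReal ((pidx n : ℝ) ^ ((p - 1) / r - 2)) * (pidx n : ℝ≥0∞)
        = ENNReal.ofReal ((pidx n : ℝ) ^ ((p - 1) / r - 1)) := by
      rw [← ENNReal.ofReal_natCast, ← ENNReal.ofReal_mul (by positivity),
        ← Real.rpow_add_one hn.ne']
      congr 2
      ring
    calc _ ≤ ENNReal.ofReal ((pidx n : ℝ) ^ ((p - 1) / r - 2)) *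
          ((pidx n : ℝ≥0∞) * ENNReal.ofReal M *
            ∫⁻ ω in {ω : Ω | (pidx n : ℝ) ^ (1 / r) < |Y ω|}, ENNReal.ofReal |Y ω| ∂P) := by
          gcongr
          exact sum_setLIntegral_abs_le_of_tail_le P _ hX hY (fun x hx => hMD x hx n)
            (by positivity)
      _ = ENNReal.ofReal M * (ENNReal.ofReal ((pidx n : ℝ) ^ ((p - 1) / r - 1)) *
            ∫⁻ ω in {ω : Ω | (pidx n : ℝ) ^ (1 / r) < |Y ω|}, ENNReal.ofReal |Y ω| ∂P) := by
          rw [← hexp]; ring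
      _ = _ := by
          rw [← lintegral_const_mul _ hY.abs.ennreal_ofReal, ← lintegral_indicator (hset n)]
          rfl
  refine (ENNReal.tsum_le_tsum hterm).trans_lt ?_
  rw [ENNReal.tsum_mul_left, ← lintegral_tsum fun n => (Measurable.ite (hset n)
    (hY.abs.ennreal_ofReal.const_mul _) measurable_const).aemeasurable]
  refine ENNReal.mul_lt_top ENNReal.ofReal_lt_top ((lintegral_mono fun ω =>
    tsum_pidx_truncated_le hp1 hp2 hr1 d (abs_nonneg (Y ω))).trans_lt ?_)
  rw [lintegral_const_mul' _ _ ENNReal.ofReal_ne_top]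
  exact ENNReal.mul_lt_top ENNReal.ofReal_lt_top hmom
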